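/- arXiv:2004.09383 — 4 statements merged into one kernel-verified Lean document; each statement's English description precedes it below -/
import Mathlib

section
/- Let f be meromorphic on ℂ with pole set P and let K ⊆ ℂ be a compact set. Then there exists a constant L ≥ 0 such that for all z, w ∈ K \ P one has χ(f(z), f(w)) ≤ L·‖z − w‖; that is, the restriction of f to K is Lipschitz continuous from the Euclidean metric on ℂ to the chordal (spherical) metric on the target. -/
open Filter Topology

/-- A bounded function of two points that is locally dominated by a multiple of the distance is
dominated by a multiple of the distance on compact sets. -/
theorem IsCompact.exists_le_mul_dist_of_locally {X : Type*} [PseudoMetricSpace X] {K : Set X}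
    (hK : IsCompact K) (s : Set X) (d : X → X → ℝ) {C : ℝ} (hC : 0 ≤ C)
    (hd : ∀ x y, d x y ≤ C)
    (hloc : ∀ x, ∃ L : ℝ, 0 ≤ L ∧ ∃ U ∈ 𝓝 x, ∀ y ∈ U \ s, ∀ z ∈ U \ s, d y z ≤ L * dist y z) :
    ∃ L : ℝ, 0 ≤ L ∧ ∀ y ∈ K \ s, ∀ z ∈ K \ s, d y z ≤ L * dist y z := by
  choose L hL U hU hLU using hloc
  obtain ⟨t, -, ht⟩ := hK.elim_nhds_subcover (fun x => interior (U x))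
    fun x _ => interior_mem_nhds.2 (hU x)
  obtain ⟨δ, hδ, hball⟩ := lebesgue_number_lemma_of_metric (ι := t) (c := fun i => interior (U i))
    hK (fun _ => isOpen_interior) (by simpa [Set.iUnion_subtype] using ht)
  have hsum : 0 ≤ ∑ i ∈ t, L i := Finset.sum_nonneg fun i _ => hL i
  refine ⟨∑ i ∈ t, L i + C / δ, by positivity, fun y hy z hz => ?_⟩
  have hCδ : 0 ≤ C / δ := by positivity
  rcases lt_or_ge (dist z y) δ with h | h
  · obtain ⟨i, hi⟩ := hball y hy.1
    calc d y z ≤ L i * dist y z :=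
          hLU i y ⟨interior_subset (hi (Metric.mem_ball_self hδ)), hy.2⟩ z
            ⟨interior_subset (hi h), hz.2⟩
      _ ≤ _ := by
          gcongr
          exact (Finset.single_le_sum (fun j _ => hL j) i.2).trans (le_add_of_nonneg_right hCδ)
  · calc d y z ≤ C / δ * δ := by rw [div_mul_cancel₀ _ hδ.ne']; exact hd y z
      _ ≤ _ := by
          rw [dist_comm] at h
          gcongr
          exact le_add_of_nonneg_left hsum

namespace Complex

theorem chordal_le_one (a b : ℂ) :
    ‖a - b‖ / (Real.sqrt (1 + ‖a‖ ^ 2) * Real.sqrt (1 + ‖b‖ ^ 2)) ≤ 1 := by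
  rw [← Real.sqrt_mul (by positivity)]
  refine div_le_one_of_le₀ ((norm_sub_le a b).trans (Real.le_sqrt_of_sq_le ?_)) (Real.sqrt_nonneg _)
  nlinarith [sq_nonneg (‖a‖ * ‖b‖ - 1)]

theorem chordal_le_norm_sub (a b : ℂ) :
    ‖a - b‖ / (Real.sqrt (1 + ‖a‖ ^ 2) * Real.sqrt (1 + ‖b‖ ^ 2)) ≤ ‖a - b‖ := by
  refine div_le_self (norm_nonneg _) (one_le_mul_of_one_le_of_one_le ?_ ?_) <;>
    exact Real.one_le_sqrt.2 (le_add_of_nonneg_right (by positivity))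

theorem chordal_le_norm_inv_sub_inv {a b : ℂ} (ha : a ≠ 0) (hb : b ≠ 0) :
    ‖a - b‖ / (Real.sqrt (1 + ‖a‖ ^ 2) * Real.sqrt (1 + ‖b‖ ^ 2)) ≤ ‖a⁻¹ - b⁻¹‖ := by
  rw [inv_sub_inv ha hb, norm_div, norm_mul, norm_sub_rev b a]
  have ha' := norm_pos_iff.2 ha
  have hb' := norm_pos_iff.2 hb
  gcongr <;> exact Real.le_sqrt_of_sq_le (by linarith)

end Complex

theorem AnalyticAt.exists_lipschitz_nhds {g : ℂ → ℂ} {z : ℂ} (hg : AnalyticAt ℂ g z) :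
    ∃ L : ℝ, 0 ≤ L ∧ ∃ U ∈ 𝓝 z, ∀ x ∈ U, ∀ y ∈ U, ‖g x - g y‖ ≤ L * dist x y := by
  obtain ⟨L, U, hU, h⟩ := (hg.contDiffAt (n := 1)).exists_lipschitzOnWith
  exact ⟨L, L.2, U, hU, fun x hx y hy => by simpa [dist_eq_norm] using h.dist_le_mul x hx y hy⟩

/-- The reciprocal of a function with a pole at `p` extends analytically by `0` to `p`. -/
theorem Complex.analyticAt_update_inv_of_tendsto_norm_atTop {f : ℂ → ℂ} {p : ℂ}
    (hd : ∀ᶠ z in 𝓝[≠] p, DifferentiableAt ℂ f z)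
    (hp : Tendsto (fun z => ‖f z‖) (𝓝[≠] p) atTop) :
    AnalyticAt ℂ (Function.update (fun z => (f z)⁻¹) p 0) p := by
  refine analyticAt_of_differentiable_on_punctured_nhds_of_continuousAt ?_ ?_
  · filter_upwards [hd, hp.eventually_gt_atTop 0, self_mem_nhdsWithin] with z hz hz0 hzp
    refine (hz.inv (norm_pos_iff.1 hz0)).congr_of_eventuallyEq ?_
    filter_upwards [isOpen_ne.mem_nhds hzp] with w hw
    exact Function.update_of_ne hw _ _
  · rw [continuousAt_update_same]
    exact tendsto_inv₀_cobounded.comp (tendsto_norm_atTop_iff_cobounded.1 hp)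

/-- Let `f` be meromorphic on `ℂ` with pole set `P` and let `K ⊆ ℂ` be compact.
Then there exists `L ≥ 0` such that for all `z, w ∈ K \ P`,
`χ(f z, f w) ≤ L * ‖z - w‖`, where `χ` is the chordal (spherical) metric. -/
theorem lipschitz_chordal_on_compact
    (f : ℂ → ℂ) (P : Set ℂ)
    (hPclosed : IsClosed P)
    (hPdiscrete : ∀ z : ℂ, ¬ AccPt z (Filter.principal P))
    (hdiff : ∀ z ∈ Pᶜ, DifferentiableAt ℂ f z)
    (hpole : ∀ p ∈ P,
      Filter.Tendsto (fun z => ‖f z‖) (nhdsWithin p {p}ᶜ) Filter.atTop)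
    (K : Set ℂ) (hK : IsCompact K) :
    ∃ L : ℝ, 0 ≤ L ∧ ∀ z ∈ K \ P, ∀ w ∈ K \ P,
      ‖f z - f w‖ / (Real.sqrt (1 + ‖f z‖ ^ 2) * Real.sqrt (1 + ‖f w‖ ^ 2))
        ≤ L * ‖z - w‖ := by
  suffices hloc : ∀ p, ∃ L : ℝ, 0 ≤ L ∧ ∃ U ∈ 𝓝 p, ∀ z ∈ U \ P, ∀ w ∈ U \ P,
      ‖f z - f w‖ / (Real.sqrt (1 + ‖f z‖ ^ 2) * Real.sqrt (1 + ‖f w‖ ^ 2)) ≤ L * dist z w by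
    simpa only [dist_eq_norm] using hK.exists_le_mul_dist_of_locally P _ zero_le_one
      (fun z w => Complex.chordal_le_one (f z) (f w)) hloc
  intro p
  by_cases hp : p ∈ P
  · have hP : ∀ᶠ z in 𝓝[≠] p, z ∈ Pᶜ := by
      simpa [accPt_iff_frequently_nhdsNE] using hPdiscrete p
    obtain ⟨L, hL, U, hU, h⟩ := (Complex.analyticAt_update_inv_of_tendsto_norm_atTop
      (hP.mono hdiff) (hpole p hp)).exists_lipschitz_nhds
    have hne : {z | z ≠ p → f z ≠ 0} ∈ 𝓝 p := eventually_nhdsWithin_iff.1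
      (((hpole p hp).eventually_gt_atTop 0).mono fun z hz => norm_pos_iff.1 hz)
    refine ⟨L, hL, _, inter_mem hU hne, fun z hz w hw => ?_⟩
    have hzp : z ≠ p := fun e => hz.2 (e ▸ hp)
    have hwp : w ≠ p := fun e => hw.2 (e ▸ hp)
    refine (Complex.chordal_le_norm_inv_sub_inv (hz.1.2 hzp) (hw.1.2 hwp)).trans ?_
    simpa [Function.update_of_ne hzp, Function.update_of_ne hwp] using h z hz.1.1 w hw.1.1
  · obtain ⟨L, hL, U, hU, h⟩ := (Complex.analyticAt_iff_eventually_differentiableAt.2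
      (eventually_of_mem (hPclosed.isOpen_compl.mem_nhds hp) hdiff)).exists_lipschitz_nhds
    exact ⟨L, hL, U, hU, fun z hz w hw =>
      (Complex.chordal_le_norm_sub _ _).trans (h z hz.1 w hw.1)⟩
end

section
/- Let w ∈ ℂ, r > 0, and m ≥ 1 be a natural number. Let h be analytic on the open ball B(w, r) with h(w) ≠ 0, and let g : ℂ → ℂ satisfy g(z) = h(z)/(z − w)^m for all z ∈ B(w, r) \ {w}. Then the spherical derivative z ↦ ‖g′(z)‖ / (1 + ‖g(z)‖²) tends to a finite limit as z → w with z ≠ w; namely, the limit equals 1/‖h(w)‖ if m = 1, and equals 0 if m ≥ 2. -/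
open Filter Topology in
/-- Away from the pole, the spherical derivative of `h z / (z - w) ^ (n + 1)` with denominators
cleared. -/
lemma spherical_derivative_div_pow_eq {w z : ℂ} (n : ℕ) {h g : ℂ → ℂ}
    (hz : z ≠ w) (hh : DifferentiableAt ℂ h z)
    (hg : g =ᶠ[𝓝 z] fun x => h x / (x - w) ^ (n + 1)) :
    ‖deriv g z‖ / (1 + ‖g z‖ ^ 2) =
      ‖deriv h z * (z - w) - (n + 1) * h z‖ * ‖z - w‖ ^ n /
        (‖z - w‖ ^ (2 * (n + 1)) + ‖h z‖ ^ 2) := by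
  have hu : z - w ≠ 0 := sub_ne_zero.2 hz
  have hpow : HasDerivAt (fun x : ℂ => (x - w) ^ (n + 1)) ((n + 1) * (z - w) ^ n) z := by
    simpa using ((hasDerivAt_id z).sub_const w).fun_pow (n + 1)
  have hderiv : deriv g z = (deriv h z * (z - w) - (n + 1) * h z) / (z - w) ^ (n + 2) := by
    rw [hg.deriv_eq, (hh.hasDerivAt.fun_div hpow (pow_ne_zero _ hu)).deriv]
    field_simp
    ring
  rw [hderiv, hg.eq_of_nhds, norm_div, norm_div, norm_pow, norm_pow]
  have hu' : 0 < ‖z - w‖ := norm_pos_iff.2 hu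
  have h1 : ‖z - w‖ ^ (2 * (n + 1)) + ‖h z‖ ^ 2 ≠ 0 := by positivity
  have h2 : 1 + (‖h z‖ / ‖z - w‖ ^ (n + 1)) ^ 2 =
      (‖z - w‖ ^ (2 * (n + 1)) + ‖h z‖ ^ 2) / ‖z - w‖ ^ (2 * (n + 1)) := by
    field_simp
    ring
  rw [h2]
  field_simp
  ring

/-- If `h` is analytic on `B(w, r)` with `h w ≠ 0`, `m ≥ 1`, and
`g z = h z / (z - w) ^ m` on `B(w, r) \ {w}`, then the spherical derivative of `g`
tends to `1 / ‖h w‖` as `z → w` (with `z ≠ w`) if `m = 1`, and tends to `0` if `m ≥ 2`. -/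
theorem spherical_derivative_limit_at_pole
    (w : ℂ) (r : ℝ) (hr : 0 < r) (m : ℕ) (hm : 1 ≤ m)
    (h : ℂ → ℂ) (hh : DifferentiableOn ℂ h (Metric.ball w r)) (hw : h w ≠ 0)
    (g : ℂ → ℂ)
    (hg : ∀ z ∈ Metric.ball w r \ {w}, g z = h z / (z - w) ^ m) :
    Filter.Tendsto (fun z => ‖deriv g z‖ / (1 + ‖g z‖ ^ 2))
      (nhdsWithin w {w}ᶜ)
      (nhds (if m = 1 then 1 / ‖h w‖ else 0)) := by
  obtain ⟨n, rfl⟩ : ∃ n, m = n + 1 := ⟨m - 1, by omega⟩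
  have hball := Metric.isOpen_ball.mem_nhds (Metric.mem_ball_self (x := w) hr)
  have han : AnalyticAt ℂ h w := hh.analyticAt hball
  have hsub : ContinuousAt (fun z : ℂ => z - w) w := by fun_prop
  have hlim : ContinuousAt (fun z => ‖deriv h z * (z - w) - (n + 1) * h z‖ * ‖z - w‖ ^ n /
      (‖z - w‖ ^ (2 * (n + 1)) + ‖h z‖ ^ 2)) w :=
    (((han.deriv.continuousAt.mul hsub).sub
      (continuousAt_const.mul han.continuousAt)).norm.mul (hsub.norm.pow n)).div
      ((hsub.norm.pow _).add (han.continuousAt.norm.pow 2)) (by simpa using hw)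
  have hval : ‖deriv h w * (w - w) - (n + 1) * h w‖ * ‖w - w‖ ^ n /
      (‖w - w‖ ^ (2 * (n + 1)) + ‖h w‖ ^ 2) = if n + 1 = 1 then 1 / ‖h w‖ else 0 := by
    rcases Nat.eq_zero_or_pos n with rfl | hn
    · have := norm_ne_zero_iff.2 hw
      simp
      field_simp
    · simp [hn.ne']
  rw [← hval]
  refine (hlim.tendsto.mono_left nhdsWithin_le_nhds).congr' ?_
  filter_upwards [self_mem_nhdsWithin, mem_nhdsWithin_of_mem_nhds hball] with z hz hzr
  refine (spherical_derivative_div_pow_eq n hz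
    (hh.differentiableAt (Metric.isOpen_ball.mem_nhds hzr)) ?_).symm
  filter_upwards [Metric.isOpen_ball.mem_nhds hzr, isOpen_ne.mem_nhds hz] with x hx hxw
  exact hg x ⟨hx, hxw⟩
end

section
/- There exists an absolute constant c > 0 with the following property. Let R > 0 and let f : ℂ → ℂ be analytic on {z ∈ ℂ : |z| > R}, and suppose M(r, f) → ∞ as r → ∞. Then there exists ρ₀ ≥ 2R such that for every ρ ≥ ρ₀ there is a radius r′ > c·M(ρ/2, f) for which the circle {w ∈ ℂ : |w| = r′} is contained in the image f({z ∈ ℂ : R < |z| < ρ}). -/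
/-- The maximum modulus of `f` on the circle of radius `r`. -/
noncomputable def maxModulus (f : ℂ → ℂ) (r : ℝ) : ℝ :=
  sSup ((fun z => ‖f z‖) '' {z : ℂ | ‖z‖ = r})

open Complex Metric Set Filter Topology

/-- If `‖f'‖ ≤ 2 ‖f' p‖` on a disc around `p`, the image of that disc contains a disc around `f p`
of radius proportional to `‖f' p‖`. -/
theorem ball_subset_image_ball_of_norm_deriv_le {f : ℂ → ℂ} {p : ℂ} {t : ℝ} (ht : 0 < t)
    (hf : DifferentiableOn ℂ f (ball p t)) (hp : deriv f p ≠ 0)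
    (hb : ∀ z ∈ ball p t, ‖deriv f z‖ ≤ 2 * ‖deriv f p‖) :
    ball (f p) (‖deriv f p‖ * t / 24) ⊆ f '' ball p t := by
  set A := ‖deriv f p‖ with hA
  have hdiff : ∀ z ∈ ball p t, DifferentiableAt ℂ f z := fun z hz =>
    hf.differentiableAt (isOpen_ball.mem_nhds hz)
  have hschwarz : ∀ z ∈ ball p t, dist (deriv f z) (deriv f p) ≤ 3 * A / t * dist z p := by
    intro z hz
    refine dist_le_div_mul_dist_of_mapsTo_ball (hf.deriv isOpen_ball) (fun w hw => ?_) hz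
    rw [mem_closedBall, dist_eq_norm]
    linarith [norm_sub_le (deriv f w) (deriv f p), hb w hw]
  have hsub : closedBall p (t / 6) ⊆ ball p t := closedBall_subset_ball (by linarith)
  have hsphere : ∀ z ∈ sphere p (t / 6), A * t / 12 ≤ ‖f z - f p‖ := by
    intro z hz
    have hbound := (convex_closedBall p (t / 6)).norm_image_sub_le_of_norm_hasDerivWithin_le
      (f := fun z => f z - deriv f p * z) (f' := fun z => deriv f z - deriv f p) (C := A / 2)
      (x := p) (y := z)
      (fun w hw => ((hdiff w (hsub hw)).hasDerivAt.sub
        (by simpa using (hasDerivAt_id w).const_mul (deriv f p))).hasDerivWithinAt)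
      (fun w hw => by
        rw [← dist_eq_norm]
        refine (hschwarz w (hsub hw)).trans ?_
        rw [mem_closedBall] at hw
        calc 3 * A / t * dist w p ≤ 3 * A / t * (t / 6) := by gcongr
          _ = A / 2 := by field_simp; ring)
      (mem_closedBall_self (by linarith)) (sphere_subset_closedBall hz)
    have hzp : ‖z - p‖ = t / 6 := by simpa [dist_eq_norm] using hz
    have htri := norm_sub_norm_le (deriv f p * (z - p)) (f z - f p)
    have heq : ‖deriv f p * (z - p) - (f z - f p)‖ =
        ‖f z - deriv f p * z - (f p - deriv f p * p)‖ := by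
      rw [← norm_neg]; congr 1; ring
    rw [heq, norm_mul, hzp, ← hA] at htri
    rw [hzp] at hbound
    linarith
  have himage := DiffContOnCl.ball_subset_image_closedBall
    (DifferentiableOn.diffContOnCl (hf.mono ((closure_ball_subset_closedBall).trans hsub)))
    (by positivity) hsphere
    (((hdiff p (mem_ball_self ht)).hasDerivAt.eventually_ne hp).frequently.filter_mono
      nhdsWithin_le_nhds)
  rw [show A * t / 24 = A * t / 12 / 2 by ring]
  exact himage.trans (image_mono hsub)

/-- A form of **Bloch's theorem**: if the image of a disc under `f` contains no disc of radius `δ`,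
then `f'` is bounded in terms of `δ` and the distance to the boundary. -/
theorem mul_norm_deriv_le_of_not_ball_subset_image {f : ℂ → ℂ} {c z : ℂ} {r R δ : ℝ} (hrR : r < R)
    (hδ : 0 < δ) (hf : DifferentiableOn ℂ f (ball c R))
    (himage : ∀ w, ¬ ball w δ ⊆ f '' ball c R) (hz : z ∈ closedBall c r) :
    (r - dist z c) * ‖deriv f z‖ ≤ 48 * δ := by
  by_contra! hlt
  have hcont : ContinuousOn (fun z => (r - dist z c) * ‖deriv f z‖) (closedBall c r) :=
    (by fun_prop : Continuous fun z => r - dist z c).continuousOn.mul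
      (((hf.deriv isOpen_ball).continuousOn.mono (closedBall_subset_ball hrR)).norm)
  obtain ⟨p, hp, hmax⟩ := (isCompact_closedBall c r).exists_isMaxOn ⟨z, hz⟩ hcont
  have hpos : 48 * δ < (r - dist p c) * ‖deriv f p‖ := hlt.trans_le (hmax hz)
  have hrp : 0 < r - dist p c :=
    pos_of_mul_pos_left (lt_trans (by positivity) hpos) (norm_nonneg _)
  have hsub : ∀ w ∈ ball p ((r - dist p c) / 2), dist w c < r - (r - dist p c) / 2 := fun w hw => by
    linarith [dist_triangle w p c, mem_ball.1 hw]
  have hball : ball p ((r - dist p c) / 2) ⊆ ball c R := fun w hw => by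
    rw [mem_ball]; linarith [hsub w hw]
  refine himage (f p) (((ball_subset_ball ?_).trans (ball_subset_image_ball_of_norm_deriv_le
    (half_pos hrp) (hf.mono hball) ?_ fun w hw => ?_)).trans (image_mono hball))
  · linarith
  · intro h0
    rw [h0, norm_zero, mul_zero] at hpos
    linarith
  · have hw' := hsub w hw
    have hle : (r - dist w c) * ‖deriv f w‖ ≤ (r - dist p c) * ‖deriv f p‖ :=
      hmax (show w ∈ closedBall c r by rw [mem_closedBall]; linarith)
    have : (r - dist p c) / 2 * ‖deriv f w‖ ≤ (r - dist w c) * ‖deriv f w‖ := by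
      gcongr; linarith
    refine le_of_mul_le_mul_left (?_ : (r - dist p c) / 2 * _ ≤ (r - dist p c) / 2 * _) (half_pos hrp)
    linarith

/-- Every disc of radius `4` contains a point at which `cosh ^ 2` is a natural number. -/
theorem exists_dist_lt_four_cosh_sq_eq_natCast (w : ℂ) :
    ∃ u : ℂ, dist u w < 4 ∧ ∃ n : ℕ, cosh u ^ 2 = n := by
  have hone := Real.one_le_cosh |w.re|
  set n := ⌊Real.cosh |w.re| ^ 2⌋₊ with hn
  have hn_le : (n : ℝ) ≤ Real.cosh |w.re| ^ 2 := Nat.floor_le (by positivity)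
  have hlt_n : Real.cosh |w.re| ^ 2 < n + 1 := Nat.lt_floor_add_one _
  have hn1 : (1 : ℝ) ≤ n := by
    exact_mod_cast (Nat.one_le_floor_iff _).2 (one_le_pow₀ hone)
  obtain ⟨y, hy0, hy⟩ : ∃ y : ℝ, 0 ≤ y ∧ Real.cosh y ^ 2 = n :=
    ⟨Real.arcosh √n, Real.arcosh_nonneg (Real.one_le_sqrt.2 hn1), by
      rw [Real.cosh_arcosh (Real.one_le_sqrt.2 hn1), Real.sq_sqrt (by positivity)]⟩
  have hyx : y ≤ |w.re| := by
    have : Real.cosh y ≤ Real.cosh |w.re| :=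
      le_of_sq_le_sq (by rwa [hy]) (by positivity)
    rwa [Real.cosh_le_cosh, abs_abs, abs_of_nonneg hy0] at this
  have hxy : |w.re| ≤ y + 2 := by
    have h1 : Real.exp |w.re| ≤ 2 * Real.cosh |w.re| := by
      rw [Real.cosh_eq]; linarith [Real.exp_pos (-|w.re|)]
    have h2 : Real.cosh y ≤ Real.exp y := by
      rw [Real.cosh_eq]; linarith [Real.exp_le_exp.2 (by linarith : -y ≤ y)]
    have h3 : 3 ≤ Real.exp 2 := by linarith [Real.add_one_le_exp (2 : ℝ)]
    have h4 : Real.exp |w.re| ^ 2 ≤ Real.exp (y + 2) ^ 2 := by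
      calc Real.exp |w.re| ^ 2 ≤ (2 * Real.cosh |w.re|) ^ 2 := by gcongr
        _ ≤ 9 * Real.cosh y ^ 2 := by rw [hy]; linarith
        _ ≤ 9 * Real.exp y ^ 2 := by gcongr
        _ = (Real.exp y * 3) ^ 2 := by ring
        _ ≤ (Real.exp y * Real.exp 2) ^ 2 := by gcongr
        _ = Real.exp (y + 2) ^ 2 := by rw [Real.exp_add]
    exact Real.exp_le_exp.1 (le_of_sq_le_sq h4 (by positivity))
  obtain ⟨x, hx, hxw⟩ : ∃ x : ℝ, Real.cosh x ^ 2 = n ∧ |x - w.re| ≤ 2 := by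
    rcases le_total 0 w.re with h | h
    · rw [abs_of_nonneg h] at hyx hxy
      exact ⟨y, hy, abs_le.2 ⟨by linarith, by linarith⟩⟩
    · rw [abs_of_nonpos h] at hyx hxy
      exact ⟨-y, by rwa [Real.cosh_neg], abs_le.2 ⟨by linarith, by linarith⟩⟩
  set m : ℤ := round (w.im / Real.pi)
  have him : |m * Real.pi - w.im| < 2 := by
    have h := abs_sub_round (w.im / Real.pi)
    rw [abs_sub_comm] at h
    have heq : m * Real.pi - w.im = (m - w.im / Real.pi) * Real.pi := by
      field_simp [Real.pi_ne_zero]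
    rw [heq, abs_mul, abs_of_pos Real.pi_pos]
    nlinarith [Real.pi_pos, Real.pi_lt_four]
  refine ⟨x + (m * Real.pi : ℝ) * I, ?_, n, ?_⟩
  · rw [dist_eq_norm]
    refine (Complex.norm_le_abs_re_add_abs_im _).trans_lt ?_
    simp only [sub_re, sub_im, add_re, add_im, ofReal_re, ofReal_im, re_ofReal_mul, im_ofReal_mul,
      I_re, I_im, mul_zero, mul_one, add_zero, zero_add]
    linarith
  · have hcos : Real.cos (m * Real.pi) ^ 2 = 1 := by
      have := Real.sin_sq_add_cos_sq (m * Real.pi)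
      rwa [Real.sin_int_mul_pi, zero_pow two_ne_zero, zero_add] at this
    rw [Complex.cosh_add, cosh_mul_I, sinh_mul_I, ← ofReal_cos, ← ofReal_sin,
      Real.sin_int_mul_pi, ← ofReal_cosh, ofReal_zero, zero_mul, mul_zero, add_zero, mul_pow,
      ← ofReal_pow, ← ofReal_pow, hx, hcos]
    simp

/-- A nonvanishing holomorphic function on a disc has a holomorphic logarithm. -/
theorem exists_differentiableOn_ball_exp_eq {g : ℂ → ℂ} {c : ℂ} {r : ℝ} (hr : 0 < r)
    (hg : DifferentiableOn ℂ g (ball c r)) (h0 : ∀ z ∈ ball c r, g z ≠ 0) :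
    ∃ L : ℂ → ℂ, DifferentiableOn ℂ L (ball c r) ∧ (∀ z ∈ ball c r, exp (L z) = g z) ∧
      L c = log (g c) := by
  obtain ⟨F, hF⟩ := ((hg.deriv isOpen_ball).div hg h0).isExactOn_ball
  have hc : c ∈ ball c r := mem_ball_self hr
  have hL : ∀ z ∈ ball c r, HasDerivAt (fun z => F z - F c + log (g c)) (deriv g z / g z) z :=
    fun z hz => ((hF z hz).sub_const _).add_const _
  refine ⟨fun z => F z - F c + log (g c),
    fun z hz => (hL z hz).differentiableAt.differentiableWithinAt, fun z hz => ?_, by simp⟩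
  have hderiv : ∀ w ∈ ball c r,
      HasDerivAt (fun z => g z * exp (-(F z - F c + log (g c)))) 0 w := by
    intro w hw
    convert! (hg.differentiableAt (isOpen_ball.mem_nhds hw)).hasDerivAt.mul (hL w hw).neg.cexp
      using 1
    field_simp [h0 w hw]
    ring
  have hconst := (convex_ball c r).norm_image_sub_le_of_norm_hasDerivWithin_le (C := 0)
    (fun w hw => (hderiv w hw).hasDerivWithinAt) (by simp) hc hz
  rw [zero_mul, norm_le_zero_iff, sub_eq_zero] at hconst
  simp only [sub_self, zero_add, exp_neg, exp_log (h0 c hc), mul_inv_cancel₀ (h0 c hc)] at hconst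
  exact ((mul_inv_eq_one₀ (exp_ne_zero _)).1 hconst).symm

/-- A holomorphic function on a disc omitting `0` and `1` is `cosh ^ 2` of a holomorphic function
there, whose value at the centre is controlled. -/
theorem exists_differentiableOn_ball_cosh_sq_eq {g : ℂ → ℂ} {c : ℂ} {r : ℝ} (hr : 0 < r)
    (hg : DifferentiableOn ℂ g (ball c r)) (h0 : ∀ z ∈ ball c r, g z ≠ 0)
    (h1 : ∀ z ∈ ball c r, g z ≠ 1) :
    ∃ H : ℂ → ℂ, DifferentiableOn ℂ H (ball c r) ∧ (∀ z ∈ ball c r, cosh (H z) ^ 2 = g z) ∧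
      ‖H c‖ ≤ 2 * ‖g c‖ + 6 := by
  have hc : c ∈ ball c r := mem_ball_self hr
  have hsqrt : ∀ k : ℂ → ℂ, DifferentiableOn ℂ k (ball c r) → (∀ z ∈ ball c r, k z ≠ 0) →
      ∃ P : ℂ → ℂ, DifferentiableOn ℂ P (ball c r) ∧ ∀ z ∈ ball c r, P z ^ 2 = k z := by
    intro k hk hk0
    obtain ⟨L, hL, hLk, -⟩ := exists_differentiableOn_ball_exp_eq hr hk hk0
    exact ⟨fun z => exp (L z / 2), (hL.div_const 2).cexp, fun z hz => by
      rw [← exp_nat_mul, ← hLk z hz]; congr 1; push_cast; ring⟩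
  obtain ⟨P, hP, hPg⟩ := hsqrt g hg h0
  obtain ⟨Q, hQ, hQg⟩ := hsqrt (fun z => g z - 1) (hg.sub_const 1)
    fun z hz => sub_ne_zero.2 (h1 z hz)
  have hPQ : ∀ z ∈ ball c r, (P z - Q z) * (P z + Q z) = 1 := fun z hz => by
    linear_combination hPg z hz - hQg z hz
  obtain ⟨H, hH, hHPQ, hHc⟩ := exists_differentiableOn_ball_exp_eq
    (g := fun z => P z - Q z) hr (hP.sub hQ)
    fun z hz => left_ne_zero_of_mul_eq_one (hPQ z hz)
  refine ⟨H, hH, fun z hz => ?_, ?_⟩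
  · have hinv : exp (-H z) = P z + Q z := by
      rw [exp_neg, hHPQ z hz]
      exact inv_eq_of_mul_eq_one_right (hPQ z hz)
    rw [Complex.cosh, hinv, hHPQ z hz, ← hPg z hz]
    ring
  · have hPc : ‖P c‖ ^ 2 = ‖g c‖ := by rw [← norm_pow, hPg c hc]
    have hQc : ‖Q c‖ ^ 2 ≤ ‖g c‖ + 1 := by
      rw [← norm_pow, hQg c hc]
      simpa using norm_sub_le (g c) 1
    have hsum : ‖P c‖ + ‖Q c‖ ≤ ‖g c‖ + 1 + 1 / 2 := by
      nlinarith [sq_nonneg (‖P c‖ - 1), sq_nonneg (‖Q c‖ - 1)]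
    have hmul : ‖P c - Q c‖ * ‖P c + Q c‖ = 1 := by rw [← norm_mul, hPQ c hc, norm_one]
    have hlog : Real.log ‖P c - Q c‖ = -Real.log ‖P c + Q c‖ := by
      rw [eq_inv_of_mul_eq_one_left hmul, Real.log_inv]
    have hsub := Real.log_le_sub_one_of_pos
      (norm_pos_iff.2 (left_ne_zero_of_mul_eq_one (hPQ c hc)))
    have hadd := Real.log_le_sub_one_of_pos
      (norm_pos_iff.2 (right_ne_zero_of_mul_eq_one (hPQ c hc)))
    rw [hHc]
    refine (Complex.norm_le_abs_re_add_abs_im _).trans ?_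
    have hre : |(log (P c - Q c)).re| ≤ ‖P c‖ + ‖Q c‖ := by
      rw [log_re, abs_le]
      constructor <;> linarith [norm_sub_le (P c) (Q c), norm_add_le (P c) (Q c)]
    have him : |(log (P c - Q c)).im| ≤ Real.pi := by
      rw [log_im]; exact abs_arg_le_pi _
    change |(log (P c - Q c)).re| + |(log (P c - Q c)).im| ≤ _
    linarith [Real.pi_lt_four, norm_nonneg (g c)]

/-- A form of **Schottky's theorem**. -/
theorem exists_norm_le_of_omits_zero_one (B : ℝ) :
    ∃ K : ℝ, ∀ (g : ℂ → ℂ) (c : ℂ) (r : ℝ), 0 < r → DifferentiableOn ℂ g (ball c r) →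
      (∀ z ∈ ball c r, g z ≠ 0) → (∀ z ∈ ball c r, g z ≠ 1) → ‖log (g c)‖ ≤ B →
      ∀ z ∈ closedBall c (r / 2), ‖g z‖ ≤ K := by
  refine ⟨Real.exp (8 * Real.exp (2 * B + 390) ^ 2), fun g c r hr hg h0 h1 hB z hz => ?_⟩
  have hhalf : closedBall c (r / 2) ⊆ ball c r := closedBall_subset_ball (by linarith)
  obtain ⟨L, hL, hLg, hLc⟩ := exists_differentiableOn_ball_exp_eq hr hg h0
  have hnorm : ‖(2 * Real.pi * I : ℂ)‖ = 2 * Real.pi := by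
    simp [abs_of_pos Real.pi_pos]
  have hint : ∀ w ∈ ball c r, ∀ n : ℕ, L w / (2 * Real.pi * I) ≠ n := by
    intro w hw n hn
    rw [div_eq_iff two_pi_I_ne_zero] at hn
    exact h1 w hw (by rw [← hLg w hw, hn, exp_nat_mul_two_pi_mul_I])
  obtain ⟨H, hH, hHL, hHc⟩ := exists_differentiableOn_ball_cosh_sq_eq hr
    (hL.div_const (2 * Real.pi * I)) (fun w hw => by simpa using hint w hw 0)
    (fun w hw => by simpa using hint w hw 1)
  have himage : ∀ w, ¬ ball w 4 ⊆ H '' ball c r := by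
    intro w hw
    obtain ⟨u, hu, n, hn⟩ := exists_dist_lt_four_cosh_sq_eq_natCast w
    obtain ⟨v, hv, rfl⟩ := hw hu
    exact hint v hv n (by rw [← hHL v hv, hn])
  have hderiv : ∀ w ∈ closedBall c (r / 2), ‖deriv H w‖ ≤ 768 / r := by
    intro w hw
    rw [mem_closedBall] at hw
    have := mul_norm_deriv_le_of_not_ball_subset_image (r := 3 * r / 4) (by linarith)
      four_pos hH himage (z := w) (by rw [mem_closedBall]; linarith)
    rw [le_div_iff₀ hr]
    nlinarith [norm_nonneg (deriv H w)]
  have hHz : ‖H z‖ ≤ 2 * B + 390 := by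
    have h := (convex_closedBall c (r / 2)).norm_image_sub_le_of_norm_deriv_le
      (fun w hw => hH.differentiableAt (isOpen_ball.mem_nhds (hhalf hw))) hderiv
      (mem_closedBall_self (by linarith)) hz
    have hzc : 768 / r * ‖z - c‖ ≤ 768 / r * (r / 2) := by
      gcongr
      simpa [dist_eq_norm] using hz
    rw [show 768 / r * (r / 2) = 384 by field_simp; norm_num] at hzc
    have hLc' : ‖L c / (2 * Real.pi * I)‖ ≤ B := by
      rw [norm_div, hnorm, hLc]
      exact (div_le_self (norm_nonneg _) (by linarith [Real.pi_gt_three])).trans hB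
    linarith [norm_le_norm_add_norm_sub' (H z) (H c)]
  have hcosh : ‖cosh (H z)‖ ≤ Real.exp (2 * B + 390) := by
    have e1 := norm_exp_le_exp_norm (H z)
    have e2 := norm_exp_le_exp_norm (-H z)
    rw [norm_neg] at e2
    have e3 := Real.exp_le_exp.2 hHz
    rw [Complex.cosh, norm_div, Complex.norm_ofNat, div_le_iff₀ two_pos]
    linarith [norm_add_le (exp (H z)) (exp (-H z))]
  have hLz : ‖L z‖ ≤ 8 * Real.exp (2 * B + 390) ^ 2 := by
    have h := hHL z (hhalf hz)
    rw [eq_div_iff two_pi_I_ne_zero] at h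
    rw [← h, norm_mul, hnorm, norm_pow, mul_comm]
    gcongr
    linarith [Real.pi_lt_four]
  rw [← hLg z (hhalf hz)]
  exact (norm_exp_le_exp_norm _).trans (Real.exp_le_exp.2 hLz)

/-- A holomorphic function on a disc that is at most `t` in modulus at the centre and omits a value
of modulus `2 t` and a value of modulus `8 t` is at most `K t` in modulus on the half disc. -/
theorem exists_norm_le_mul_of_omits :
    ∃ K : ℝ, 1 ≤ K ∧ ∀ (h : ℂ → ℂ) (c a b : ℂ) (r t : ℝ), 0 < r → 0 < t →
      DifferentiableOn ℂ h (ball c r) → ‖a‖ = 2 * t → ‖b‖ = 8 * t →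
      (∀ z ∈ ball c r, h z ≠ a) → (∀ z ∈ ball c r, h z ≠ b) → ‖h c‖ ≤ t →
      ∀ z ∈ closedBall c (r / 2), ‖h z‖ ≤ K * t := by
  obtain ⟨K, hK⟩ := exists_norm_le_of_omits_zero_one 13
  refine ⟨10 * |K| + 2, by linarith [abs_nonneg K],
    fun h c a b r t hr ht hh ha hb hah hbh hc z hz => ?_⟩
  have hba_le : ‖b - a‖ ≤ 10 * t := by linarith [norm_sub_le b a]
  have hba_ge : 6 * t ≤ ‖b - a‖ := by linarith [norm_sub_norm_le b a]
  have hba : b - a ≠ 0 := norm_pos_iff.1 (by linarith)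
  have hca_le : ‖h c - a‖ ≤ 3 * t := by linarith [norm_sub_le (h c) a]
  have hca_ge : t ≤ ‖h c - a‖ := by linarith [norm_sub_norm_le a (h c), norm_sub_rev a (h c)]
  have hlog : ‖log ((h c - a) / (b - a))‖ ≤ 13 := by
    have hle : ‖(h c - a) / (b - a)‖ ≤ 1 := by
      rw [norm_div]; exact div_le_one_of_le₀ (by linarith) (norm_nonneg _)
    have hge : 1 / 10 ≤ ‖(h c - a) / (b - a)‖ := by
      rw [norm_div, le_div_iff₀ (by linarith)]; linarith
    have hpos : 0 < ‖(h c - a) / (b - a)‖ := by linarith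
    have hre : |(log ((h c - a) / (b - a))).re| ≤ 9 := by
      rw [log_re, abs_le]
      constructor
      · have h1 := Real.one_sub_inv_le_log_of_pos hpos
        have h2 : ‖(h c - a) / (b - a)‖⁻¹ ≤ (1 / 10)⁻¹ := by gcongr
        rw [one_div, inv_inv] at h2
        linarith
      · linarith [Real.log_nonpos hpos.le hle]
    have him : |(log ((h c - a) / (b - a))).im| ≤ Real.pi := by
      rw [log_im]; exact abs_arg_le_pi _
    linarith [Complex.norm_le_abs_re_add_abs_im (log ((h c - a) / (b - a))), Real.pi_lt_four]
  have hbound := hK (fun w => (h w - a) / (b - a)) c r hr ((hh.sub_const a).div_const _)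
    (fun w hw => div_ne_zero (sub_ne_zero.2 (hah w hw)) hba)
    (fun w hw hw1 => hbh w hw (by simpa using (div_eq_one_iff_eq hba).1 hw1)) hlog z hz
  rw [norm_div, div_le_iff₀ (by linarith)] at hbound
  have : K * ‖b - a‖ ≤ |K| * (10 * t) := by
    gcongr; exact le_abs_self K
  linarith [norm_le_norm_add_norm_sub' (h z) a]

theorem isPreconnected_setOf_lt_norm {R : ℝ} (hR : 0 < R) : IsPreconnected {z : ℂ | R < ‖z‖} := by
  have himage : {z : ℂ | R < ‖z‖} = exp '' {z : ℂ | Real.log R < z.re} := by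
    ext z
    constructor
    · intro hz
      have hz' : 0 < ‖z‖ := hR.trans hz
      exact ⟨log z, by rw [mem_ofPred_eq, log_re]; exact Real.log_lt_log hR hz,
        exp_log (norm_pos_iff.1 hz')⟩
    · rintro ⟨w, hw, rfl⟩
      rwa [mem_ofPred_eq, norm_exp, ← Real.log_lt_iff_lt_exp hR]
  rw [himage]
  exact (convex_halfSpace_re_gt _).isPreconnected.image _ continuous_exp.continuousOn

/-- If `f` is large on the outer boundary of an annulus and small on the inner boundary, its image
contains every intermediate circle. -/
theorem sphere_subset_image_annulus {f : ℂ → ℂ} {s t σ : ℝ} (hs : 0 < s) (hst : s ≤ t)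
    (hf : ContinuousOn f {z | s ≤ ‖z‖ ∧ ‖z‖ ≤ t}) (hopen : IsOpen (f '' {z | s < ‖z‖ ∧ ‖z‖ < t}))
    (hin : ∀ z, ‖z‖ = s → ‖f z‖ < σ) (hout : ∀ z, ‖z‖ = t → σ < ‖f z‖) :
    sphere 0 σ ⊆ f '' {z | s < ‖z‖ ∧ ‖z‖ < t} := by
  have hcompact : IsCompact {z : ℂ | s ≤ ‖z‖ ∧ ‖z‖ ≤ t} := by
    refine (isCompact_closedBall (0 : ℂ) t).of_isClosed_subset ?_ fun z hz => by simpa using hz.2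
    exact (isClosed_le continuous_const continuous_norm).inter
      (isClosed_le continuous_norm continuous_const)
  have hmem : ∀ z, s ≤ ‖z‖ ∧ ‖z‖ ≤ t → ‖f z‖ = σ → s < ‖z‖ ∧ ‖z‖ < t := fun z hz hzσ =>
    ⟨lt_of_le_of_ne hz.1 fun h => (hin z h.symm).ne hzσ,
      lt_of_le_of_ne hz.2 fun h => (hout z h).ne' hzσ⟩
  refine IsPreconnected.subset_left_of_subset_union hopen
    (hcompact.image_of_continuousOn hf).isClosed.isOpen_compl ?_ ?_ ?_
    (isPreconnected_sphere (by simp) 0 σ)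
  · exact disjoint_compl_right_iff_subset.2 (image_mono fun z hz => ⟨hz.1.le, hz.2.le⟩)
  · intro w hw
    by_cases h : w ∈ f '' {z : ℂ | s ≤ ‖z‖ ∧ ‖z‖ ≤ t}
    · obtain ⟨z, hz, rfl⟩ := h
      exact Or.inl ⟨z, hmem z hz (by simpa using hw), rfl⟩
    · exact Or.inr h
  · have hnorm : ∀ x ∈ Icc s t, ‖(x : ℂ)‖ = x := fun x hx => by
      rw [norm_real, Real.norm_of_nonneg (hs.le.trans hx.1)]
    have hcont : ContinuousOn (fun x : ℝ => ‖f x‖) (Icc s t) :=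
      (hf.comp continuous_ofReal.continuousOn fun x hx => by
        rw [mem_ofPred_eq, hnorm x hx]; exact hx).norm
    obtain ⟨x, hx, hxσ⟩ := intermediate_value_Icc hst hcont
      ⟨(hin s (hnorm s (left_mem_Icc.2 hst))).le, (hout t (hnorm t (right_mem_Icc.2 hst))).le⟩
    exact ⟨f x, by simpa using hxσ, x, hmem x (by rw [hnorm x hx]; exact hx) hxσ, rfl⟩

theorem norm_le_maxModulus {f : ℂ → ℂ} {r : ℝ} (hf : ContinuousOn f {z | ‖z‖ = r}) {z : ℂ}
    (hz : ‖z‖ = r) : ‖f z‖ ≤ maxModulus f r := by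
  have hS : {z : ℂ | ‖z‖ = r} = sphere 0 r := by ext; simp
  refine le_csSup ?_ (mem_image_of_mem _ hz)
  rw [hS] at hf ⊢
  exact ((isCompact_sphere 0 r).image_of_continuousOn hf.norm).bddAbove

/-- If `f` omits, on an annulus around the circle of radius `s`, a value of every modulus greater
than `T`, and `‖f‖ ≤ T` at some point of that circle, then `‖f‖ ≤ K ^ 26 * T` on the whole circle,
where `K` is the constant of `exists_norm_le_mul_of_omits`. -/
theorem norm_le_pow_mul_of_omits {K : ℝ} (hK1 : 1 ≤ K)
    (hK : ∀ (h : ℂ → ℂ) (c a b : ℂ) (r t : ℝ), 0 < r → 0 < t →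
      DifferentiableOn ℂ h (ball c r) → ‖a‖ = 2 * t → ‖b‖ = 8 * t →
      (∀ z ∈ ball c r, h z ≠ a) → (∀ z ∈ ball c r, h z ≠ b) → ‖h c‖ ≤ t →
      ∀ z ∈ closedBall c (r / 2), ‖h z‖ ≤ K * t)
    {f : ℂ → ℂ} {s T : ℝ} (hs : 0 < s) (hT : 0 < T)
    (hf : DifferentiableOn ℂ f {z | s / 2 < ‖z‖ ∧ ‖z‖ < 2 * s})
    (homit : ∀ σ, T < σ → ∃ w, ‖w‖ = σ ∧ w ∉ f '' {z | s / 2 < ‖z‖ ∧ ‖z‖ < 2 * s})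
    {z₀ z₁ : ℂ} (hz₀ : ‖z₀‖ = s) (hz₁ : ‖z₁‖ = s) (hfz₀ : ‖f z₀‖ ≤ T) :
    ‖f z₁‖ ≤ K ^ 26 * T := by
  set δ := (arg z₁ - arg z₀) / 26 with hδ
  have hδ_le : |δ| ≤ 1 / 4 := by
    have h0 := abs_le.1 (abs_arg_le_pi z₀)
    have h1 := abs_le.1 (abs_arg_le_pi z₁)
    rw [hδ, abs_le]
    constructor <;> linarith [Real.pi_lt_d2]
  have hstep : ∀ n : ℕ, ‖f (z₀ * exp (n * δ * I))‖ ≤ K ^ n * T := by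
    intro n
    induction n with
    | zero => simpa using hfz₀
    | succ n ih =>
      set c := z₀ * exp (n * δ * I) with hc
      have hcs : ‖c‖ = s := by
        rw [hc, norm_mul, hz₀, ← ofReal_natCast, ← ofReal_mul, norm_exp_ofReal_mul_I, mul_one]
      have hKn : 1 ≤ K ^ n := one_le_pow₀ hK1
      have hT' : T ≤ K ^ n * T := le_mul_of_one_le_left hT.le hKn
      have hsub : ball c (s / 2) ⊆ {z | s / 2 < ‖z‖ ∧ ‖z‖ < 2 * s} := by
        intro z hz
        rw [mem_ball, dist_eq_norm] at hz
        constructor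
        · linarith [norm_sub_norm_le c z, norm_sub_rev c z]
        · linarith [norm_le_norm_add_norm_sub' z c]
      obtain ⟨a, ha, ha'⟩ := homit (2 * (K ^ n * T)) (by linarith)
      obtain ⟨b, hb, hb'⟩ := homit (8 * (K ^ n * T)) (by linarith)
      rw [pow_succ', mul_assoc K]
      refine hK f c a b (s / 2) (K ^ n * T) (by linarith) (by positivity) (hf.mono hsub) ha hb
        (fun z hz h => ha' ⟨z, hsub hz, h⟩) (fun z hz h => hb' ⟨z, hsub hz, h⟩) ih _ ?_
      have heq : z₀ * exp ((n + 1 : ℕ) * δ * I) - c = c * (exp (I * δ) - 1) := by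
        rw [hc, mul_sub, mul_assoc z₀ _ (exp _), ← Complex.exp_add]
        push_cast
        ring_nf
      rw [mem_closedBall, dist_eq_norm, heq, norm_mul, hcs]
      calc s * ‖exp (I * δ) - 1‖ ≤ s * (1 / 4) := by
            gcongr
            exact (Real.norm_exp_I_mul_ofReal_sub_one_le).trans hδ_le
        _ = s / 2 / 2 := by ring
  convert! hstep 26 using 3
  rw [← norm_mul_exp_arg_mul_I z₀, ← norm_mul_exp_arg_mul_I z₁, hz₀, hz₁, mul_assoc,
    ← Complex.exp_add]
  congr 2
  rw [hδ]
  push_cast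
  ring

/-- Bohr's theorem, Domínguez's version. There is an absolute constant
`c > 0` so that for every `R > 0` and every `f` analytic on `{|z| > R}` with
`M(r, f) → ∞` as `r → ∞`, there exists `ρ₀ ≥ 2R` such that for all `ρ ≥ ρ₀` there is
`r′ > c · M(ρ/2, f)` with the circle of radius `r′` contained in the image of the
annulus `{R < |z| < ρ}` under `f`. -/
theorem bohr_dominguez :
    ∃ c : ℝ, 0 < c ∧
      ∀ R : ℝ, 0 < R →
        ∀ f : ℂ → ℂ, DifferentiableOn ℂ f {z : ℂ | R < ‖z‖} →
          Filter.Tendsto (fun r => maxModulus f r) Filter.atTop Filter.atTop →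
          ∃ ρ₀ : ℝ, 2 * R ≤ ρ₀ ∧
            ∀ ρ : ℝ, ρ₀ ≤ ρ →
              ∃ r' : ℝ, c * maxModulus f (ρ / 2) < r' ∧
                {w : ℂ | ‖w‖ = r'} ⊆ f '' {z : ℂ | R < ‖z‖ ∧ ‖z‖ < ρ} := by
  obtain ⟨K, hK1, hK⟩ := exists_norm_le_mul_of_omits
  have hKpos : 0 < K ^ 26 := by positivity
  refine ⟨(2 * K ^ 26)⁻¹, by positivity, fun R hR f hf hM => ?_⟩
  set c := (2 * K ^ 26)⁻¹ with hc
  have hcpos : 0 < c := by positivity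
  have hopenU : IsOpen {z : ℂ | R < ‖z‖} := isOpen_lt continuous_const continuous_norm
  have hcircle : ∀ r, R < r → ContinuousOn f {z | ‖z‖ = r} := fun r hr =>
    hf.continuousOn.mono fun z (hz : ‖z‖ = r) => show R < ‖z‖ by rwa [hz]
  have hcompact : ∀ r, IsCompact {z : ℂ | ‖z‖ = r} := fun r => by
    convert isCompact_sphere (0 : ℂ) r using 1
    ext; simp
  have hnonempty : ∀ r : ℝ, 0 ≤ r → {z : ℂ | ‖z‖ = r}.Nonempty := fun r hr =>
    ⟨r, by simp [abs_of_nonneg hr]⟩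
  have hopen : ∀ s ⊆ {z : ℂ | R < ‖z‖}, IsOpen s → IsOpen (f '' s) := by
    refine ((hf.analyticOnNhd hopenU).is_constant_or_isOpen
      (isPreconnected_setOf_lt_norm hR)).resolve_left ?_
    rintro ⟨w, hw⟩
    obtain ⟨r, hr, hRr⟩ := ((hM.eventually_gt_atTop ‖w‖).and (eventually_gt_atTop R)).exists
    refine hr.not_ge (csSup_le ((hnonempty r (hR.trans hRr).le).image _) ?_)
    rintro _ ⟨z, hz : ‖z‖ = r, rfl⟩
    exact (congrArg norm (hw z (show R < ‖z‖ by rwa [hz]))).le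
  obtain ⟨r₀, hr₀⟩ := eventually_atTop.1
    (hM.eventually_gt_atTop (max 0 (maxModulus f (2 * R) / c)))
  refine ⟨max (4 * R) (2 * r₀), by linarith [le_max_left (4 * R) (2 * r₀)], fun ρ hρ => ?_⟩
  have hρR : 4 * R ≤ ρ := (le_max_left _ _).trans hρ
  have hρr : r₀ ≤ ρ / 2 := by linarith [(le_max_right (4 * R) (2 * r₀)).trans hρ]
  have hpos : 0 < maxModulus f (ρ / 2) := (le_max_left _ _).trans_lt (hr₀ _ hρr)
  have hlarge : maxModulus f (2 * R) < c * maxModulus f (ρ / 2) := by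
    rw [← div_lt_iff₀' hcpos]
    exact (le_max_right _ _).trans_lt (hr₀ _ hρr)
  by_contra! hnot
  obtain ⟨z₀, hz₀, hmin⟩ := (hcompact (ρ / 2)).exists_isMinOn (hnonempty _ (by linarith))
    (hcircle _ (by linarith)).norm
  obtain ⟨z₁, hz₁, hmax⟩ := (hcompact (ρ / 2)).exists_sSup_image_eq (hnonempty _ (by linarith))
    (hcircle _ (by linarith)).norm
  have hsmall : ‖f z₀‖ ≤ c * maxModulus f (ρ / 2) := by
    by_contra! hlt
    obtain ⟨σ, hσ, hσ'⟩ := exists_between hlt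
    have hsub := sphere_subset_image_annulus (f := f) (s := 2 * R) (t := ρ / 2) (σ := σ)
      (by linarith) (by linarith)
      (hf.continuousOn.mono fun z hz => show R < ‖z‖ by linarith [hz.1])
      (hopen _ (fun z hz => show R < ‖z‖ by linarith [hz.1])
        ((isOpen_lt continuous_const continuous_norm).inter
          (isOpen_lt continuous_norm continuous_const)))
      (fun z hz => (norm_le_maxModulus (hcircle _ (by linarith)) hz).trans_lt (hlarge.trans hσ))
      (fun z hz => hσ'.trans_le (hmin hz))
    refine hnot σ hσ fun w hw => ?_
    obtain ⟨z, hz, hzw⟩ := hsub (show w ∈ sphere 0 σ by simpa using hw)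
    exact ⟨z, ⟨by linarith [hz.1], by linarith [hz.2]⟩, hzw⟩
  have hsub : {z : ℂ | ρ / 2 / 2 < ‖z‖ ∧ ‖z‖ < 2 * (ρ / 2)} ⊆ {z | R < ‖z‖ ∧ ‖z‖ < ρ} :=
    fun z hz => ⟨by linarith [hz.1], by linarith [hz.2]⟩
  have hfinal := norm_le_pow_mul_of_omits hK1 hK (by linarith) (by positivity)
    (hf.mono (hsub.trans fun z hz => hz.1))
    (fun σ hσ => by
      obtain ⟨w, hw, hw'⟩ := not_subset.1 (hnot σ hσ)
      exact ⟨w, hw, fun h => hw' (image_mono hsub h)⟩)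
    hz₀ hz₁ hsmall
  have hz₁_eq : maxModulus f (ρ / 2) = ‖f z₁‖ := hmax
  rw [← hz₁_eq, hc, ← mul_assoc, mul_inv, mul_left_comm, mul_inv_cancel₀ hKpos.ne'] at hfinal
  linarith
end

section
/- Let f be meromorphic on ℂ with finite pole set P, and let (E_n), for n ∈ ℕ, be a sequence of nonempty compact subsets of ℂ such that E_{n+1} ⊆ f(E_n \ P) for all n ∈ ℕ. Then there exists a point z ∈ E_0 such that for every n ∈ ℕ, the n-th iterate f^[n](z) is defined (i.e. f^[k](z) ∉ P for all k) and f^[n](z) ∈ E_n. -/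
/-- The points of `E n` whose first `k` orbit steps avoid `P` and pass successively through
`E (n + 1), …, E (n + k)`. -/
def itinerarySet {X : Type*} (f : X → X) (P : Set X) (E : ℕ → Set X) : ℕ → ℕ → Set X
  | 0, n => E n
  | k + 1, n => E n ∩ (Pᶜ ∩ f ⁻¹' itinerarySet f P E k (n + 1))

section itinerarySet

variable {X : Type*} {f : X → X} {P : Set X} {E : ℕ → Set X}

theorem itinerarySet_subset (k n : ℕ) : itinerarySet f P E k n ⊆ E n := by
  cases k with
  | zero => exact subset_rfl
  | succ k => exact Set.inter_subset_left

theorem itinerarySet_succ_subset (k n : ℕ) :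
    itinerarySet f P E (k + 1) n ⊆ itinerarySet f P E k n := by
  induction k generalizing n with
  | zero => exact itinerarySet_subset 1 n
  | succ k ih => exact fun z hz => ⟨hz.1, hz.2.1, ih (n + 1) hz.2.2⟩

theorem itinerarySet_nonempty (hne : ∀ n, (E n).Nonempty)
    (hsub : ∀ n, E (n + 1) ⊆ f '' (E n \ P)) (k n : ℕ) :
    (itinerarySet f P E k n).Nonempty := by
  induction k generalizing n with
  | zero => exact hne n
  | succ k ih =>
    obtain ⟨w, hw⟩ := ih (n + 1)
    obtain ⟨z, hz, rfl⟩ := hsub n (itinerarySet_subset k (n + 1) hw)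
    exact ⟨z, hz.1, hz.2, hw⟩

theorem isCompact_itinerarySet [TopologicalSpace X]
    (hclosed : ∀ C : Set X, IsCompact C → IsClosed (Pᶜ ∩ f ⁻¹' C))
    (hcpt : ∀ n, IsCompact (E n)) (k n : ℕ) : IsCompact (itinerarySet f P E k n) := by
  induction k generalizing n with
  | zero => exact hcpt n
  | succ k ih => exact (hcpt n).inter_right (hclosed _ (ih (n + 1)))

theorem iterate_mem_itinerarySet {z : X} (n k : ℕ) (hz : z ∈ itinerarySet f P E (k + n) 0) :
    f^[n] z ∈ itinerarySet f P E k n := by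
  induction n generalizing k with
  | zero => exact hz
  | succ n ih =>
    rw [Function.iterate_succ_apply']
    exact (ih (k + 1) (by rwa [Nat.add_right_comm])).2.2

end itinerarySet

/-- Away from its poles, a function has closed preimages of compact sets, even as subsets of the
whole space. -/
theorem isClosed_compl_inter_preimage_of_tendsto_norm_atTop {X F : Type*} [TopologicalSpace X]
    [SeminormedAddCommGroup F] [T2Space F] {f : X → F} {P : Set X}
    (hf : ∀ z ∈ Pᶜ, ContinuousAt f z)
    (hpole : ∀ p ∈ P, Filter.Tendsto (fun z => ‖f z‖) (nhdsWithin p {p}ᶜ) Filter.atTop)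
    {C : Set F} (hC : IsCompact C) : IsClosed (Pᶜ ∩ f ⁻¹' C) := by
  rw [← isOpen_compl_iff, isOpen_iff_mem_nhds]
  intro z hz
  by_cases hzP : z ∈ P
  · obtain ⟨R, hR⟩ := hC.isBounded.exists_norm_le
    have h := eventually_nhdsWithin_iff.1 ((hpole z hzP).eventually_gt_atTop R)
    filter_upwards [h] with w hw
    rintro ⟨hwP, hwC⟩
    have hwz : w ≠ z := fun h => hwP (h ▸ hzP)
    exact (hw hwz).not_ge (hR _ hwC)
  · have hfz : f z ∉ C := fun h => hz ⟨hzP, h⟩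
    filter_upwards [(hf z hzP).eventually_mem (hC.isClosed.isOpen_compl.mem_nhds hfz)]
      with w hw using fun h => hw h.2

/-- Let `f` be meromorphic on `ℂ` with finite pole set `P`, and let
`(E n)` be nonempty compact sets with `E (n+1) ⊆ f (E n \ P)` for all `n`. Then there is
`z ∈ E 0` whose orbit is defined (never hits a pole) and satisfies `f^[n] z ∈ E n` for
all `n`. -/
theorem orbit_through_compact_sets
    (f : ℂ → ℂ) (P : Set ℂ) (hPfin : P.Finite)
    (hdiff : ∀ z ∈ Pᶜ, DifferentiableAt ℂ f z)
    (hpole : ∀ p ∈ P,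
      Filter.Tendsto (fun z => ‖f z‖) (nhdsWithin p {p}ᶜ) Filter.atTop)
    (E : ℕ → Set ℂ)
    (hEcpt : ∀ n, IsCompact (E n))
    (hEne : ∀ n, (E n).Nonempty)
    (hEsub : ∀ n, E (n + 1) ⊆ f '' (E n \ P)) :
    ∃ z ∈ E 0, (∀ k : ℕ, f^[k] z ∉ P) ∧ ∀ n : ℕ, f^[n] z ∈ E n := by
  have hclosed (C : Set ℂ) (hC : IsCompact C) : IsClosed (Pᶜ ∩ f ⁻¹' C) :=
    isClosed_compl_inter_preimage_of_tendsto_norm_atTop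
      (fun z hz => (hdiff z hz).continuousAt) hpole hC
  have hcpt := isCompact_itinerarySet hclosed hEcpt
  obtain ⟨z, hz⟩ := IsCompact.nonempty_iInter_of_sequence_nonempty_isCompact_isClosed
    (fun k => itinerarySet f P E k 0) (fun k => itinerarySet_succ_subset k 0)
    (fun k => itinerarySet_nonempty hEne hEsub k 0) (hcpt 0 0) (fun k => (hcpt k 0).isClosed)
  rw [Set.mem_iInter] at hz
  exact ⟨z, hz 0, fun k => (iterate_mem_itinerarySet k 1 (hz _)).2.1,
    fun n => iterate_mem_itinerarySet n 0 (hz _)⟩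
end
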